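/- arXiv:1002.0558 — 2 statements merged into one kernel-verified Lean document; each statement's English description precedes it below -/
import Mathlib

section
/- Let ℓ ≥ 2 and let ī, j̄ ∈ ℤ/ℓℤ with j̄ ≠ ī, j̄ ≠ ī + 1 and j̄ ≠ ī − 1 in ℤ/ℓℤ. Then the Misra–Miwa operators on the v-deformed Fock space F_v satisfy E_ī E_j̄ = E_j̄ E_ī as ℚ(v)-linear endomorphisms of F_v. -/
open scoped Classical

namespace MisraMiwa

/-- The content of a box `b = (i, j)` (row `i`, column `j`, indexed from 0): column minus row. -/
def content (b : ℕ × ℕ) : ℤ := (b.2 : ℤ) - (b.1 : ℤ)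

/-- The color of a box: its content modulo `ℓ`. -/
def color (ℓ : ℕ) (b : ℕ × ℕ) : ZMod ℓ := (content b : ZMod ℓ)

/-- `b` is an addable box of the partition (Young diagram) `μ`. -/
def IsAddable (μ : YoungDiagram) (b : ℕ × ℕ) : Prop :=
  b ∉ μ ∧ ∃ ν : YoungDiagram, (ν : Set (ℕ × ℕ)) = insert b (μ : Set (ℕ × ℕ))

/-- `b` is a removable box of the partition (Young diagram) `μ`. -/
def IsRemovable (μ : YoungDiagram) (b : ℕ × ℕ) : Prop :=
  b ∈ μ ∧ ∃ ν : YoungDiagram, (ν : Set (ℕ × ℕ)) = (μ : Set (ℕ × ℕ)) \ {b}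

/-- The partition obtained from `μ` by adding the addable box `b`. -/
noncomputable def added (μ : YoungDiagram) (b : ℕ × ℕ) : YoungDiagram :=
  if h : IsAddable μ b then h.2.choose else μ

/-- The partition obtained from `μ` by removing the removable box `b`. -/
noncomputable def erased (μ : YoungDiagram) (b : ℕ × ℕ) : YoungDiagram :=
  if h : IsRemovable μ b then h.2.choose else μ

/-- `A ℓ i μ` : the set of addable boxes of `μ` of color `i`. -/
def A (ℓ : ℕ) (i : ZMod ℓ) (μ : YoungDiagram) : Set (ℕ × ℕ) :=
  {b | IsAddable μ b ∧ color ℓ b = i}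

/-- `R ℓ i μ` : the set of removable boxes of `μ` of color `i`. -/
def R (ℓ : ℕ) (i : ZMod ℓ) (μ : YoungDiagram) : Set (ℕ × ℕ) :=
  {b | IsRemovable μ b ∧ color ℓ b = i}

/-- `Nc ℓ i μ = #A_i(μ) - #R_i(μ)`. -/
noncomputable def Nc (ℓ : ℕ) (i : ZMod ℓ) (μ : YoungDiagram) : ℤ :=
  ((A ℓ i μ).ncard : ℤ) - ((R ℓ i μ).ncard : ℤ)

/-- `b'` is to the left of `b` : its content is strictly larger. -/
def LeftOf (b' b : ℕ × ℕ) : Prop := content b < content b'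

/-- `b'` is to the right of `b` : its content is strictly smaller. -/
def RightOf (b' b : ℕ × ℕ) : Prop := content b' < content b

/-- `Nl ℓ i μ b` : number of removable boxes of `μ` of color `i` to the left of `b`
minus number of addable boxes of `μ` of color `i` to the left of `b`. -/
noncomputable def Nl (ℓ : ℕ) (i : ZMod ℓ) (μ : YoungDiagram) (b : ℕ × ℕ) : ℤ :=
  ({b' | b' ∈ R ℓ i μ ∧ LeftOf b' b}.ncard : ℤ) - ({b' | b' ∈ A ℓ i μ ∧ LeftOf b' b}.ncard : ℤ)

/-- `Nr ℓ i μ b` : as `Nl`, but to the right of `b`. -/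
noncomputable def Nr (ℓ : ℕ) (i : ZMod ℓ) (μ : YoungDiagram) (b : ℕ × ℕ) : ℤ :=
  ({b' | b' ∈ R ℓ i μ ∧ RightOf b' b}.ncard : ℤ) - ({b' | b' ∈ A ℓ i μ ∧ RightOf b' b}.ncard : ℤ)

/-- The `v`-deformed Fock space: the `ℚ(v)`-vector space with basis indexed by partitions. -/
abbrev Fock : Type := YoungDiagram →₀ RatFunc ℚ

/-- The indeterminate `v` of `ℚ(v)`. -/
noncomputable def v : RatFunc ℚ := RatFunc.X

/-- `E_i |λ⟩ = Σ_μ v^(-N^r_i(λ/μ)) |μ⟩`, sum over `μ ⊂ λ` with `λ/μ` one box of color `i`. -/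
noncomputable def Evec (ℓ : ℕ) (i : ZMod ℓ) (lam : YoungDiagram) : Fock :=
  ∑ᶠ b ∈ R ℓ i lam,
    v ^ (-Nr ℓ i (erased lam b) b) • Finsupp.single (erased lam b) (1 : RatFunc ℚ)

/-- `F_i |λ⟩ = Σ_μ v^(N^l_i(μ/λ)) |μ⟩`, sum over `μ ⊃ λ` with `μ/λ` one box of color `i`. -/
noncomputable def Fvec (ℓ : ℕ) (i : ZMod ℓ) (lam : YoungDiagram) : Fock :=
  ∑ᶠ b ∈ A ℓ i lam,
    v ^ (Nl ℓ i lam b) • Finsupp.single (added lam b) (1 : RatFunc ℚ)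

/-- The Misra–Miwa operator `E_i`. -/
noncomputable def Eop (ℓ : ℕ) (i : ZMod ℓ) : Fock →ₗ[RatFunc ℚ] Fock :=
  Finsupp.lsum (RatFunc ℚ) fun lam => LinearMap.toSpanSingleton (RatFunc ℚ) Fock (Evec ℓ i lam)

/-- The Misra–Miwa operator `F_i`. -/
noncomputable def Fop (ℓ : ℕ) (i : ZMod ℓ) : Fock →ₗ[RatFunc ℚ] Fock :=
  Finsupp.lsum (RatFunc ℚ) fun lam => LinearMap.toSpanSingleton (RatFunc ℚ) Fock (Fvec ℓ i lam)

/-- The Misra–Miwa operator `K_i` : `K_i |λ⟩ = v^(N_i(λ)) |λ⟩`. -/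
noncomputable def Kop (ℓ : ℕ) (i : ZMod ℓ) : Fock →ₗ[RatFunc ℚ] Fock :=
  Finsupp.lsum (RatFunc ℚ) fun lam =>
    LinearMap.toSpanSingleton (RatFunc ℚ) Fock (v ^ Nc ℓ i lam • Finsupp.single lam (1 : RatFunc ℚ))

/-- The inverse operator `K_i⁻¹ |λ⟩ = v^(-N_i(λ)) |λ⟩`. -/
noncomputable def Kinvop (ℓ : ℕ) (i : ZMod ℓ) : Fock →ₗ[RatFunc ℚ] Fock :=
  Finsupp.lsum (RatFunc ℚ) fun lam =>
    LinearMap.toSpanSingleton (RatFunc ℚ) Fock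
      (v ^ (-Nc ℓ i lam) • Finsupp.single lam (1 : RatFunc ℚ))

/-- The Cartan matrix entry of affine type `A^{(1)}_{ℓ-1}`. -/
noncomputable def cartan (ℓ : ℕ) (i j : ZMod ℓ) : ℤ :=
  2 * (if i = j then 1 else 0)
    - (({1, -1} : Finset ℤ).filter (fun e => j = i + (e : ZMod ℓ))).card

/-- The `q`-integer `[n] = (q^n - q^{-n})/(q - q⁻¹)` in `ℚ(q)` (here `q = v`). -/
noncomputable def qint (n : ℤ) : RatFunc ℚ := (v ^ n - v ^ (-n)) / (v - v⁻¹)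

/-- `hasVal p x n` : the nonzero rational function `x` has `p`-adic valuation `n`. -/
def hasVal (p : Polynomial ℚ) (x : RatFunc ℚ) (n : ℤ) : Prop :=
  ∃ a b : Polynomial ℚ, ¬ p ∣ a ∧ ¬ p ∣ b ∧
    x = algebraMap (Polynomial ℚ) (RatFunc ℚ) p ^ n *
        (algebraMap (Polynomial ℚ) (RatFunc ℚ) a / algebraMap (Polynomial ℚ) (RatFunc ℚ) b)

/-- Addable boxes of `μ` in rows strictly above row `k` (rows indexed from 0). -/
def Alt (μ : YoungDiagram) (k : ℕ) : Set (ℕ × ℕ) := {b | IsAddable μ b ∧ b.1 < k}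

/-- Removable boxes of `μ` in rows strictly above row `k` (rows indexed from 0). -/
def Rlt (μ : YoungDiagram) (k : ℕ) : Set (ℕ × ℕ) := {b | IsRemovable μ b ∧ b.1 < k}

/-- The degree-`n` component of Fock space: the span of `|λ⟩` for `|λ| = n`. -/
noncomputable def degComp (n : ℕ) : Submodule (RatFunc ℚ) Fock :=
  Submodule.span (RatFunc ℚ)
    {f | ∃ lam : YoungDiagram, lam.card = n ∧ f = Finsupp.single lam (1 : RatFunc ℚ)}


/-- `d` is obtained from `c` by one step down or one step right. -/
def Step (c d : ℕ × ℕ) : Prop :=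
  (c.1 + 1 = d.1 ∧ c.2 = d.2) ∨ (c.1 = d.1 ∧ c.2 + 1 = d.2)

theorem step_content {c d : ℕ × ℕ} (h : Step c d) :
    content d = content c + 1 ∨ content d = content c - 1 := by
  unfold Step at h
  unfold content
  omega

theorem step_color (ℓ : ℕ) {c d : ℕ × ℕ} (h : Step c d) :
    color ℓ d = color ℓ c + 1 ∨ color ℓ d = color ℓ c - 1 := by
  unfold color
  rcases step_content h with h | h <;> rw [h] <;> simp

/-- If `b < c` there is a step from `b` staying below `c`. -/
theorem exists_step_up {b c : ℕ × ℕ} (h : b ≤ c) (hne : b ≠ c) : ∃ d, Step b d ∧ d ≤ c := by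
  obtain ⟨b1, b2⟩ := b
  obtain ⟨c1, c2⟩ := c
  rw [Prod.mk_le_mk] at h
  by_cases h1 : b1 < c1
  · exact ⟨(b1 + 1, b2), Or.inl ⟨rfl, rfl⟩, by rw [Prod.mk_le_mk]; omega⟩
  · have : b2 < c2 := by
      by_contra h2
      exact hne (by rw [Prod.mk.injEq]; omega)
    exact ⟨(b1, b2 + 1), Or.inr ⟨rfl, rfl⟩, by rw [Prod.mk_le_mk]; omega⟩

theorem exists_step_down {b c : ℕ × ℕ} (h : c ≤ b) (hne : c ≠ b) : ∃ d, Step d b ∧ c ≤ d := by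
  obtain ⟨b1, b2⟩ := b
  obtain ⟨c1, c2⟩ := c
  rw [Prod.mk_le_mk] at h
  by_cases h1 : c1 < b1
  · exact ⟨(b1 - 1, b2), Or.inl ⟨by simp only; omega, rfl⟩, by rw [Prod.mk_le_mk]; omega⟩
  · have : c2 < b2 := by
      by_contra h2
      exact hne (by rw [Prod.mk.injEq]; omega)
    exact ⟨(b1, b2 - 1), Or.inr ⟨rfl, by simp only; omega⟩, by rw [Prod.mk_le_mk]; omega⟩

theorem step_le {c d : ℕ × ℕ} (h : Step c d) : c ≤ d := by
  rw [Prod.le_def]; unfold Step at h; omega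

theorem step_ne {c d : ℕ × ℕ} (h : Step c d) : c ≠ d := by
  rintro rfl; unfold Step at h; omega

theorem isRemovable_iff (μ : YoungDiagram) (b : ℕ × ℕ) :
    IsRemovable μ b ↔ b ∈ μ ∧ ∀ d, Step b d → d ∉ μ := by
  constructor
  · rintro ⟨hb, ν, hν⟩
    refine ⟨hb, fun d hd hdμ => ?_⟩
    have h1 : d ∈ (ν : Set (ℕ × ℕ)) := by
      rw [hν]; exact ⟨hdμ, fun h => step_ne hd h.symm⟩
    have h2 : b ∈ (ν : Set (ℕ × ℕ)) := ν.isLowerSet (step_le hd) h1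
    rw [hν] at h2
    exact h2.2 rfl
  · rintro ⟨hb, h⟩
    refine ⟨hb, ⟨μ.cells.erase b, ?_⟩, ?_⟩
    · intro x y hyx hx
      simp only [Finset.coe_erase, Set.mem_sdiff, Set.mem_singleton_iff] at hx ⊢
      refine ⟨μ.isLowerSet hyx hx.1, ?_⟩
      rintro rfl
      obtain ⟨d, hd, hdx⟩ := exists_step_up hyx (Ne.symm hx.2)
      exact h d hd (μ.isLowerSet hdx hx.1)
    · ext x
      change x ∈ μ.cells.erase b ↔ _
      simp [and_comm]

theorem isAddable_iff (μ : YoungDiagram) (b : ℕ × ℕ) :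
    IsAddable μ b ↔ b ∉ μ ∧ ∀ d, Step d b → d ∈ μ := by
  constructor
  · rintro ⟨hb, ν, hν⟩
    refine ⟨hb, fun d hd => ?_⟩
    have h1 : b ∈ (ν : Set (ℕ × ℕ)) := by
      rw [hν]; exact Set.mem_insert _ _
    have h2 : d ∈ (ν : Set (ℕ × ℕ)) := ν.isLowerSet (step_le hd) h1
    rw [hν] at h2
    exact h2.resolve_left (step_ne hd)
  · rintro ⟨hb, h⟩
    refine ⟨hb, ⟨insert b μ.cells, ?_⟩, ?_⟩
    · intro x y hyx hx
      simp only [Finset.coe_insert, Set.mem_insert_iff] at hx ⊢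
      rcases hx with rfl | hx
      · by_cases hy : y = x
        · exact Or.inl hy
        · obtain ⟨d, hd, hyd⟩ := exists_step_down hyx hy
          exact Or.inr (μ.isLowerSet hyd (h d hd))
      · exact Or.inr (μ.isLowerSet hyx hx)
    · ext x
      change x ∈ insert b μ.cells ↔ _
      simp

theorem mem_erased {μ : YoungDiagram} {b : ℕ × ℕ} (h : IsRemovable μ b) (c : ℕ × ℕ) :
    c ∈ erased μ b ↔ c ∈ μ ∧ c ≠ b := by
  have h1 : ((erased μ b : YoungDiagram) : Set (ℕ × ℕ)) = (μ : Set (ℕ × ℕ)) \ {b} := by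
    unfold erased
    rw [dif_pos h]
    exact h.2.choose_spec
  have h2 := Set.ext_iff.1 h1 c
  simpa using h2

section far

variable {ℓ : ℕ} {i j : ZMod ℓ}

theorem R_erased (h1 : j ≠ i) (h2 : j ≠ i + 1) (h3 : j ≠ i - 1) {μ : YoungDiagram} {b : ℕ × ℕ}
    (hb : b ∈ R ℓ i μ) : R ℓ j (erased μ b) = R ℓ j μ := by
  ext c
  obtain ⟨hb, hbi⟩ := hb
  simp only [R, Set.mem_ofPred_eq]
  refine and_congr_left fun hc => ?_
  have hcb : c ≠ b := by rintro rfl; exact h1 (hc.symm.trans hbi)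
  rw [isRemovable_iff, isRemovable_iff, mem_erased hb]
  refine and_congr (and_iff_left hcb) (forall_congr' fun d => imp_congr_right fun hd => ?_)
  have hdb : d ≠ b := by
    rintro rfl
    rcases step_color ℓ hd with h | h <;> rw [hc, hbi] at h
    · exact h3 (by rw [h]; ring)
    · exact h2 (by rw [h]; ring)
  rw [mem_erased hb, and_iff_left hdb]

theorem A_erased (h1 : j ≠ i) (h2 : j ≠ i + 1) (h3 : j ≠ i - 1) {μ : YoungDiagram} {b : ℕ × ℕ}
    (hb : b ∈ R ℓ i μ) : A ℓ j (erased μ b) = A ℓ j μ := by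
  ext c
  obtain ⟨hb, hbi⟩ := hb
  simp only [A, Set.mem_ofPred_eq]
  refine and_congr_left fun hc => ?_
  have hcb : c ≠ b := by rintro rfl; exact h1 (hc.symm.trans hbi)
  rw [isAddable_iff, isAddable_iff, mem_erased hb, and_iff_left hcb]
  refine and_congr Iff.rfl (forall_congr' fun d => imp_congr_right fun hd => ?_)
  have hdb : d ≠ b := by
    rintro rfl
    rcases step_color ℓ hd with h | h <;> rw [hc, hbi] at h
    · exact h2 h
    · exact h3 h
  rw [mem_erased hb, and_iff_left hdb]

theorem Nr_erased (h1 : j ≠ i) (h2 : j ≠ i + 1) (h3 : j ≠ i - 1) {μ : YoungDiagram} {b : ℕ × ℕ}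
    (hb : b ∈ R ℓ i μ) (c : ℕ × ℕ) : Nr ℓ j (erased μ b) c = Nr ℓ j μ c := by
  unfold Nr
  rw [R_erased h1 h2 h3 hb, A_erased h1 h2 h3 hb]

end far

theorem erased_comm {μ : YoungDiagram} {b c : ℕ × ℕ} (hb : IsRemovable μ b)
    (hc : IsRemovable μ c) (hbc : IsRemovable (erased μ b) c) (hcb : IsRemovable (erased μ c) b) :
    erased (erased μ b) c = erased (erased μ c) b := by
  apply SetLike.ext
  intro x
  rw [mem_erased hbc, mem_erased hb, mem_erased hcb, mem_erased hc]
  tauto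

theorem R_finite (ℓ : ℕ) (i : ZMod ℓ) (μ : YoungDiagram) : (R ℓ i μ).Finite :=
  μ.cells.finite_toSet.subset fun _ h => h.1.1

theorem Eop_single (ℓ : ℕ) (i : ZMod ℓ) (μ : YoungDiagram) :
    Eop ℓ i (Finsupp.single μ 1) = Evec ℓ i μ := by
  simp [Eop]

theorem Eop_Evec (ℓ : ℕ) (i j : ZMod ℓ) (μ : YoungDiagram) :
    Eop ℓ i (Evec ℓ j μ) = ∑ᶠ b ∈ R ℓ j μ, ∑ᶠ c ∈ R ℓ i (erased μ b),
      v ^ (-Nr ℓ j (erased μ b) b) • v ^ (-Nr ℓ i (erased (erased μ b) c) c) •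
        Finsupp.single (erased (erased μ b) c) (1 : RatFunc ℚ) := by
  unfold Evec
  rw [← LinearMap.toAddMonoidHom_coe, AddMonoidHom.map_finsum_mem _ _ (R_finite ℓ j μ)]
  refine finsum_mem_congr rfl fun b _ => ?_
  rw [LinearMap.toAddMonoidHom_coe, map_smul, Eop_single, Evec, smul_finsum_mem (R_finite _ _ _)]

theorem stmt3 (ℓ : ℕ) (hℓ : 2 ≤ ℓ) (i j : ZMod ℓ)
    (h1 : j ≠ i) (h2 : j ≠ i + 1) (h3 : j ≠ i - 1) :
    Eop ℓ i ∘ₗ Eop ℓ j = Eop ℓ j ∘ₗ Eop ℓ i := by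
  have k1 : i ≠ j := h1.symm
  have k2 : i ≠ j + 1 := fun h => h3 (by rw [h]; ring)
  have k3 : i ≠ j - 1 := fun h => h2 (by rw [h]; ring)
  refine Finsupp.lhom_ext' fun μ => LinearMap.ext_ring ?_
  simp only [LinearMap.comp_apply, Finsupp.lsingle_apply, Eop_single, Eop_Evec]
  have e1 : ∀ b ∈ R ℓ j μ, R ℓ i (erased μ b) = R ℓ i μ := fun b hb => R_erased k1 k2 k3 hb
  have e2 : ∀ b ∈ R ℓ i μ, R ℓ j (erased μ b) = R ℓ j μ := fun b hb => R_erased h1 h2 h3 hb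
  rw [finsum_mem_congr rfl fun b hb => finsum_mem_congr (e1 b hb) fun _ _ => rfl,
    finsum_mem_comm _ (R_finite ℓ j μ) (R_finite ℓ i μ)]
  refine finsum_mem_congr rfl fun c hc => ?_
  refine finsum_mem_congr (e2 c hc).symm fun b hb => ?_
  have hb' := hb
  rw [e2 c hc] at hb
  have hc' : c ∈ R ℓ i (erased μ b) := by rw [e1 b hb]; exact hc
  rw [← Nr_erased h1 h2 h3 hc', ← Nr_erased k1 k2 k3 hb',
    erased_comm hc.1 hb.1 hb'.1 hc'.1, smul_comm]

end MisraMiwa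
end

section
/- Let ℓ ≥ 2 and let ī, j̄ ∈ ℤ/ℓℤ with j̄ ≠ ī, j̄ ≠ ī + 1 and j̄ ≠ ī − 1 in ℤ/ℓℤ. Then the Misra–Miwa operators on the v-deformed Fock space F_v satisfy F_ī F_j̄ = F_j̄ F_ī as ℚ(v)-linear endomorphisms of F_v. -/
open scoped Classical

namespace MisraMiwa

theorem isAddable_iff_s4 (μ : YoungDiagram) (r c : ℕ) :
    IsAddable μ (r, c) ↔ (r, c) ∉ μ ∧ (∀ r', r' + 1 = r → (r', c) ∈ μ) ∧
      (∀ c', c' + 1 = c → (r, c') ∈ μ) := by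
  constructor
  · rintro ⟨hn, ν, hν⟩
    have hm : ∀ x, x ∈ ν ↔ x = (r, c) ∨ x ∈ μ := fun x => by
      have := Set.ext_iff.1 hν x
      simpa using this
    have hb : (r, c) ∈ ν := (hm _).2 (Or.inl rfl)
    refine ⟨hn, ?_, ?_⟩
    · intro r' h
      have h' : (r', c) ∈ ν := ν.up_left_mem (by omega) le_rfl hb
      rcases (hm _).1 h' with h'' | h''
      · simp at h''; omega
      · exact h''
    · intro c' h
      have h' : (r, c') ∈ ν := ν.up_left_mem le_rfl (by omega) hb
      rcases (hm _).1 h' with h'' | h''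
      · simp at h''; omega
      · exact h''
  · rintro ⟨hn, hr, hc⟩
    refine ⟨hn, ⟨insert (r, c) μ.cells, ?_⟩, ?_⟩
    · rintro ⟨x, y⟩ ⟨x', y'⟩ hle hx
      simp only [Prod.mk_le_mk] at hle
      simp only [Finset.coe_insert, Set.mem_insert_iff, Finset.mem_coe, YoungDiagram.mem_cells,
        Prod.mk.injEq] at hx ⊢
      rcases hx with ⟨rfl, rfl⟩ | hx
      · by_cases h1 : x' = x
        · by_cases h2 : y' = y
          · exact Or.inl ⟨h1, h2⟩
          · exact Or.inr (μ.up_left_mem hle.1 (by omega) (hc (y - 1) (by omega)))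
        · exact Or.inr (μ.up_left_mem (by omega) hle.2 (hr (x - 1) (by omega)))
      · exact Or.inr (μ.up_left_mem hle.1 hle.2 hx)
    · ext x
      simp [← YoungDiagram.mem_cells]

theorem isRemovable_iff_s4 (μ : YoungDiagram) (r c : ℕ) :
    IsRemovable μ (r, c) ↔ (r, c) ∈ μ ∧ (r + 1, c) ∉ μ ∧ (r, c + 1) ∉ μ := by
  constructor
  · rintro ⟨hn, ν, hν⟩
    have hm : ∀ x, x ∈ ν ↔ x ∈ μ ∧ x ≠ (r, c) := fun x => by
      have := Set.ext_iff.1 hν x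
      simpa using this
    have hb : (r, c) ∉ ν := fun h => ((hm _).1 h).2 rfl
    refine ⟨hn, ?_, ?_⟩
    · intro h
      exact hb (ν.up_left_mem (Nat.le_succ r) le_rfl ((hm _).2 ⟨h, by simp⟩))
    · intro h
      exact hb (ν.up_left_mem le_rfl (Nat.le_succ c) ((hm _).2 ⟨h, by simp⟩))
  · rintro ⟨hn, hr, hc⟩
    refine ⟨hn, ⟨μ.cells.erase (r, c), ?_⟩, ?_⟩
    · rintro ⟨x, y⟩ ⟨x', y'⟩ hle hx
      simp only [Prod.mk_le_mk] at hle
      simp only [Finset.coe_erase, Set.mem_sdiff, Finset.mem_coe, YoungDiagram.mem_cells,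
        Set.mem_singleton_iff, Prod.mk.injEq] at hx ⊢
      refine ⟨μ.up_left_mem hle.1 hle.2 hx.1, ?_⟩
      rintro ⟨rfl, rfl⟩
      by_cases h1 : x = x'
      · exact hc (μ.up_left_mem hle.1 (by omega) hx.1)
      · exact hr (μ.up_left_mem (by omega) hle.2 hx.1)
    · ext x
      simp [← YoungDiagram.mem_cells, and_comm]

theorem mem_added {μ : YoungDiagram} {b : ℕ × ℕ} (h : IsAddable μ b) (x : ℕ × ℕ) :
    x ∈ added μ b ↔ x = b ∨ x ∈ μ := by
  have := Set.ext_iff.1 h.2.choose_spec x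
  rw [added, dif_pos h]
  simpa using this

theorem added_comm {μ : YoungDiagram} {a b : ℕ × ℕ} (ha : IsAddable μ a) (hb : IsAddable μ b)
    (hab : IsAddable (added μ b) a) (hba : IsAddable (added μ a) b) :
    added (added μ b) a = added (added μ a) b := by
  apply YoungDiagram.ext
  ext x
  rw [YoungDiagram.mem_cells, YoungDiagram.mem_cells, mem_added hab, mem_added hba,
    mem_added ha, mem_added hb]
  tauto

theorem mem_added_of_color {ℓ : ℕ} {μ : YoungDiagram} {b x : ℕ × ℕ} (h : IsAddable μ b)
    (hc : color ℓ x ≠ color ℓ b) : x ∈ added μ b ↔ x ∈ μ := by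
  rw [mem_added h]
  constructor
  · rintro (rfl | h)
    · exact absurd rfl hc
    · exact h
  · exact Or.inr

theorem A_added {ℓ : ℕ} {i j : ZMod ℓ} (h1 : j ≠ i) (h2 : j ≠ i + 1) (h3 : j ≠ i - 1)
    {μ : YoungDiagram} {b : ℕ × ℕ} (hb : b ∈ A ℓ j μ) : A ℓ i (added μ b) = A ℓ i μ := by
  obtain ⟨hb, rfl⟩ := hb
  ext ⟨r, c⟩
  refine and_congr_left fun hi => ?_
  subst hi
  rw [isAddable_iff_s4, isAddable_iff_s4, mem_added_of_color hb h1.symm]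
  refine and_congr_right fun _ => and_congr ?_ ?_
  · refine forall_congr' fun r' => imp_congr_right fun hr => ?_
    refine mem_added_of_color (ℓ := ℓ) hb fun h => h2 ?_
    subst hr
    rw [← h]; simp [color, content]; ring
  · refine forall_congr' fun r' => imp_congr_right fun hr => ?_
    refine mem_added_of_color (ℓ := ℓ) hb fun h => h3 ?_
    subst hr
    rw [← h]; simp [color, content]; ring

theorem R_added {ℓ : ℕ} {i j : ZMod ℓ} (h1 : j ≠ i) (h2 : j ≠ i + 1) (h3 : j ≠ i - 1)
    {μ : YoungDiagram} {b : ℕ × ℕ} (hb : b ∈ A ℓ j μ) : R ℓ i (added μ b) = R ℓ i μ := by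
  obtain ⟨hb, rfl⟩ := hb
  ext ⟨r, c⟩
  refine and_congr_left fun hi => ?_
  subst hi
  rw [isRemovable_iff_s4, isRemovable_iff_s4, mem_added_of_color hb h1.symm]
  refine and_congr_right fun _ => and_congr (not_congr ?_) (not_congr ?_)
  · refine mem_added_of_color (ℓ := ℓ) hb fun h => h3 ?_
    rw [← h]; simp [color, content]; ring
  · refine mem_added_of_color (ℓ := ℓ) hb fun h => h2 ?_
    rw [← h]; simp [color, content]; ring

theorem A_finite (ℓ : ℕ) (i : ZMod ℓ) (μ : YoungDiagram) : (A ℓ i μ).Finite := by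
  refine Set.Finite.subset (((Set.finite_singleton ((0 : ℕ), (0 : ℕ))).union
    (μ.cells.finite_toSet.image fun x => (x.1 + 1, x.2))).union
    (μ.cells.finite_toSet.image fun x => (x.1, x.2 + 1))) ?_
  rintro ⟨r, c⟩ ⟨h, -⟩
  rw [isAddable_iff_s4] at h
  obtain ⟨-, hr, hc⟩ := h
  rcases r with _ | r
  · rcases c with _ | c
    · simp
    · right
      exact ⟨(0, c), by simpa using hc c rfl, rfl⟩
  · left; right
    exact ⟨(r, c), by simpa using hr r rfl, rfl⟩

theorem Fvec_eq (ℓ : ℕ) (i : ZMod ℓ) (μ : YoungDiagram) :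
    Fvec ℓ i μ = ∑ b ∈ (A_finite ℓ i μ).toFinset,
      v ^ (Nl ℓ i μ b) • Finsupp.single (added μ b) (1 : RatFunc ℚ) :=
  finsum_mem_eq_finite_toFinset_sum _ _

theorem Fop_single (ℓ : ℕ) (i : ZMod ℓ) (μ : YoungDiagram) :
    Fop ℓ i (Finsupp.single μ 1) = Fvec ℓ i μ := by
  simp [Fop]

theorem Fop_Fvec {ℓ : ℕ} {i j : ZMod ℓ} (h1 : j ≠ i) (h2 : j ≠ i + 1) (h3 : j ≠ i - 1)
    (μ : YoungDiagram) :
    Fop ℓ i (Fvec ℓ j μ) = ∑ b ∈ (A_finite ℓ j μ).toFinset, ∑ a ∈ (A_finite ℓ i μ).toFinset,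
      (v ^ (Nl ℓ j μ b) * v ^ (Nl ℓ i μ a)) •
        Finsupp.single (added (added μ b) a) (1 : RatFunc ℚ) := by
  rw [Fvec_eq, map_sum]
  refine Finset.sum_congr rfl fun b hb => ?_
  have hb' : b ∈ A ℓ j μ := by simpa using hb
  have hA := A_added h1 h2 h3 hb'
  have hR := R_added h1 h2 h3 hb'
  rw [map_smul, Fop_single, Fvec_eq, Finset.smul_sum]
  refine Finset.sum_congr ?_ fun a _ => ?_
  · ext x; simp [hA]
  · have hN : Nl ℓ i (added μ b) a = Nl ℓ i μ a := by rw [Nl, hA, hR, ← Nl]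
    rw [smul_smul, hN]

theorem stmt4 (ℓ : ℕ) (hℓ : 2 ≤ ℓ) (i j : ZMod ℓ)
    (h1 : j ≠ i) (h2 : j ≠ i + 1) (h3 : j ≠ i - 1) :
    Fop ℓ i ∘ₗ Fop ℓ j = Fop ℓ j ∘ₗ Fop ℓ i := by
  apply Finsupp.lhom_ext'
  intro μ
  ext1
  simp only [LinearMap.comp_apply, Finsupp.lsingle_apply, Fop_single]
  have h2' : i ≠ j + 1 := fun h => h3 (by rw [h]; ring)
  have h3' : i ≠ j - 1 := fun h => h2 (by rw [h]; ring)
  rw [Fop_Fvec h1 h2 h3, Fop_Fvec h1.symm h2' h3', Finset.sum_comm]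
  refine Finset.sum_congr rfl fun a ha => Finset.sum_congr rfl fun b hb => ?_
  have ha' : a ∈ A ℓ i μ := by simpa using ha
  have hb' : b ∈ A ℓ j μ := by simpa using hb
  have hab : a ∈ A ℓ i (added μ b) := by rw [A_added h1 h2 h3 hb']; exact ha'
  have hba : b ∈ A ℓ j (added μ a) := by rw [A_added h1.symm h2' h3' ha']; exact hb'
  rw [mul_comm, added_comm ha'.1 hb'.1 hab.1 hba.1]

end MisraMiwa
end
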